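/- Let F = Π.φ be a closed prenex QBF and let C ∈ φ be a clause having the property QIOR⁺ on an existential literal ℓ ∈ C with respect to the QBF F′ = Π′.φ′, where φ′ = φ \ {C} and Π′ is Π with the variables (and their quantifiers) that no longer occur in φ′ removed. Then F and F′ are satisfiability-equivalent, i.e., F is true if and only if F′ is true. -/

import Mathlib

attribute [local instance] Classical.propDecidable

namespace QHornProlog

/-- Propositional variables. -/
abbrev Var := ℕ
/-- A literal is a variable together with a polarity (`true` = positive). -/
abbrev Lit := Var × Bool
/-- A clause is a finite set of literals. -/
abbrev Clause := Finset Lit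
/-- A CNF formula is a finite set of clauses. -/
abbrev CNF := Finset Clause
/-- A Boolean assignment to the variables. -/
abbrev Assignment := Var → Bool

/-- An assignment makes a literal true. -/
def litSat (a : Assignment) (l : Lit) : Prop := a l.1 = l.2
/-- An assignment satisfies a clause if some literal of it is made true. -/
def clauseSat (a : Assignment) (C : Clause) : Prop := ∃ l ∈ C, litSat a l
/-- An assignment satisfies a CNF if it satisfies every clause. -/
def cnfSat (a : Assignment) (F : CNF) : Prop := ∀ C ∈ F, clauseSat a C
/-- A CNF formula is satisfiable if some assignment satisfies it. -/
def CnfSatisfiable (F : CNF) : Prop := ∃ a, cnfSat a F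

/-- The positive literals of a clause. -/
def posLits (C : Clause) : Clause := C.filter (fun l => l.2 = true)
/-- A Horn clause has at most one positive literal. -/
def IsHornClause (C : Clause) : Prop := (posLits C).card ≤ 1
/-- A definite Horn clause has exactly one positive literal. -/
def IsDefiniteClause (C : Clause) : Prop := (posLits C).card = 1
/-- A negative (goal) clause has only negative literals. -/
def IsNegativeClause (C : Clause) : Prop := ∀ l ∈ C, l.2 = false
/-- A Horn formula consists of Horn clauses. -/
def IsHornFormula (F : CNF) : Prop := ∀ C ∈ F, IsHornClause C

/-- `R` is the resolvent of `C` and `D` on pivot `x`. -/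
def IsResolvent (C D R : Clause) (x : Var) : Prop :=
  (x, true) ∈ C ∧ (x, false) ∈ D ∧ R = C.erase (x, true) ∪ D.erase (x, false)

/-- A unit resolution refutation of `F`: a sequence of clauses ending in the empty
clause, each either in `F` or a resolvent of two earlier clauses where at least one
premise is a unit clause. -/
def IsUnitResRefutation (F : CNF) (L : List Clause) : Prop :=
  L ≠ [] ∧ L.getLast? = some (∅ : Clause) ∧
  ∀ i (hi : i < L.length),
    L.get ⟨i, hi⟩ ∈ F ∨
    ∃ j k, ∃ (hj : j < i) (hk : k < i), ∃ x : Var,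
      ((L.get ⟨j, hj.trans hi⟩).card = 1 ∨ (L.get ⟨k, hk.trans hi⟩).card = 1) ∧
      IsResolvent (L.get ⟨j, hj.trans hi⟩) (L.get ⟨k, hk.trans hi⟩) (L.get ⟨i, hi⟩) x

/-- An SLD-resolution refutation of `F`: a sequence of negative clauses starting at a
goal clause of `F`, each next clause the resolvent of the previous (centre) clause with
a definite clause of `F` (side clause) on its head, ending in the empty clause. -/
def IsSLDRefutation (F : CNF) (L : List Clause) : Prop :=
  ∃ h : L ≠ [],
    L.head h ∈ F ∧ IsNegativeClause (L.head h) ∧ L.getLast h = (∅ : Clause) ∧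
    ∀ i (hi : i + 1 < L.length),
      ∃ C ∈ F, ∃ x : Var,
        posLits C = {(x, true)} ∧ (x, false) ∈ L.get ⟨i, Nat.lt_of_succ_lt hi⟩ ∧
        L.get ⟨i + 1, hi⟩ =
          (L.get ⟨i, Nat.lt_of_succ_lt hi⟩).erase (x, false) ∪ C.erase (x, true)

/-! ### Quantified Boolean formulas in closed prenex form -/

/-- A quantifier prefix: a list of blocks, each a quantifier (`true` = ∃, `false` = ∀)
together with a finite set of variables. -/
abbrev QPrefix := List (Bool × Finset Var)

/-- All variables occurring in the prefix. -/
def prefixVars (Pf : QPrefix) : Finset Var := Pf.foldr (fun p s => p.2 ∪ s) ∅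
/-- Variables of a clause. -/
def clauseVars (C : Clause) : Finset Var := C.image Prod.fst
/-- Variables of a CNF. -/
def cnfVars (F : CNF) : Finset Var := F.sup clauseVars

/-- Override an assignment on the set `X` by the assignment `b`. -/
def override (a : Assignment) (X : Finset Var) (b : Assignment) : Assignment :=
  fun v => if v ∈ X then b v else a v

/-- Recursive truth evaluation of a prenex QBF relative to an ambient assignment:
an ∃-block requires some assignment of its variables, a ∀-block requires all. -/
def QEval : QPrefix → CNF → Assignment → Prop
  | [], φ, a => cnfSat a φ
  | (true, X) :: Pf, φ, a => ∃ b, QEval Pf φ (override a X b)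
  | (false, X) :: Pf, φ, a => ∀ b, QEval Pf φ (override a X b)

/-- Truth of a closed prenex QBF. -/
def QTrue (Pf : QPrefix) (φ : CNF) : Prop := QEval Pf φ (fun _ => false)

/-- `Pf.φ` is a closed prenex QBF: the blocks are pairwise disjoint and every variable
of the matrix is quantified. -/
def ClosedQBF (Pf : QPrefix) (φ : CNF) : Prop :=
  Pf.Pairwise (fun p q => Disjoint p.2 q.2) ∧ cnfVars φ ⊆ prefixVars Pf

/-- A variable is existential if it lies in an ∃-block. -/
def IsExistential (Pf : QPrefix) (v : Var) : Prop := ∃ p ∈ Pf, p.1 = true ∧ v ∈ p.2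
/-- A variable is universal if it lies in a ∀-block. -/
def IsUniversal (Pf : QPrefix) (v : Var) : Prop := ∃ p ∈ Pf, p.1 = false ∧ v ∈ p.2
/-- A quantified Horn formula: a closed prenex QBF with a Horn matrix. -/
def IsQHorn (Pf : QPrefix) (φ : CNF) : Prop := ClosedQBF Pf φ ∧ IsHornFormula φ

/-- Variable `v` lies in block number `i` (0-indexed) of the prefix. -/
def hasLevel (Pf : QPrefix) (v : Var) (i : ℕ) : Prop :=
  ∃ h : i < Pf.length, v ∈ (Pf.get ⟨i, h⟩).2
/-- Variable `v` is at or to the left of variable `w` in the prefix ordering. -/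
def levelLE (Pf : QPrefix) (v w : Var) : Prop :=
  ∃ i j, i ≤ j ∧ hasLevel Pf v i ∧ hasLevel Pf w j

/-- Clauses of the matrix with exactly one positive literal, which is existential. -/
noncomputable def Fexist (Pf : QPrefix) (φ : CNF) : CNF :=
  φ.filter (fun C => ∃ x, posLits C = {(x, true)} ∧ IsExistential Pf x)
/-- Clauses of the matrix with exactly one positive literal, which is universal. -/
noncomputable def Fforall (Pf : QPrefix) (φ : CNF) : CNF :=
  φ.filter (fun C => ∃ x, posLits C = {(x, true)} ∧ IsUniversal Pf x)
/-- Goal clauses: clauses with only negative literals. -/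
noncomputable def Fgoal (φ : CNF) : CNF := φ.filter IsNegativeClause

/-- One SLD-Q-resolution step from centre clause `N` to `N'`: either resolution with a
definite clause of `φ` on its existential head, or universal reduction of a universal
literal not blocked by any existential literal at or to its right. -/
def SLDQStep (Pf : QPrefix) (φ : CNF) (N N' : Clause) : Prop :=
  (∃ C ∈ φ, ∃ x : Var, posLits C = {(x, true)} ∧ IsExistential Pf x ∧
     (x, false) ∈ N ∧ N' = N.erase (x, false) ∪ C.erase (x, true)) ∨
  (∃ l ∈ N, IsUniversal Pf l.1 ∧
     (∀ k ∈ N, IsExistential Pf k.1 → ¬ levelLE Pf l.1 k.1) ∧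
     N' = N.erase l)

/-- An SLD-Q-resolution refutation of `Pf.φ`: a sequence of negative clauses starting
at a goal clause of `φ`, proceeding by SLD-Q-resolution steps, ending in the empty
clause. -/
def IsSLDQRefutation (Pf : QPrefix) (φ : CNF) (L : List Clause) : Prop :=
  ∃ h : L ≠ [],
    L.head h ∈ φ ∧ IsNegativeClause (L.head h) ∧ L.getLast h = (∅ : Clause) ∧
    ∀ i (hi : i + 1 < L.length),
      SLDQStep Pf φ (L.get ⟨i, Nat.lt_of_succ_lt hi⟩) (L.get ⟨i + 1, hi⟩)

/-! ### Skolem-function models and logical equivalence -/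

/-- A family of candidate Skolem functions: to every variable a function from
assignments to Booleans. -/
abbrev SkolemFamily := Var → Assignment → Bool

/-- Variables of the first `i` blocks of the prefix. -/
def varsUpTo (Pf : QPrefix) (i : ℕ) : Finset Var := prefixVars (Pf.take i)

/-- Each Skolem function for an existential variable depends only on the variables
quantified to the left of it (i.e. in strictly earlier blocks). -/
def DependsOnlyOuter (Pf : QPrefix) (σ : SkolemFamily) : Prop :=
  ∀ i (hi : i < Pf.length), (Pf.get ⟨i, hi⟩).1 = true →
    ∀ v ∈ (Pf.get ⟨i, hi⟩).2, ∀ a b : Assignment,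
      (∀ w ∈ varsUpTo Pf i, a w = b w) → σ v a = σ v b

/-- A complete assignment is consistent with the Skolem family if every existential
variable takes the value prescribed by its Skolem function. -/
def ConsistentWith (Pf : QPrefix) (σ : SkolemFamily) (a : Assignment) : Prop :=
  ∀ v, IsExistential Pf v → a v = σ v a

/-- `σ` is a model of `Pf.φ`: its functions depend only on outer variables and every
consistent complete assignment satisfies the matrix. -/
def IsModel (Pf : QPrefix) (φ : CNF) (σ : SkolemFamily) : Prop :=
  DependsOnlyOuter Pf σ ∧ ∀ a : Assignment, ConsistentWith Pf σ a → cnfSat a φ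

/-- Two QBFs with the same prefix are logically equivalent iff they have exactly the
same models. -/
def LogEquiv (Pf : QPrefix) (φ φ' : CNF) : Prop :=
  ∀ σ : SkolemFamily, IsModel Pf φ σ ↔ IsModel Pf φ' σ

/-- The abstraction `Pf_i`: all variables of the first `i` blocks are made existential
and put in a single leading ∃-block. -/
def abstraction (Pf : QPrefix) (i : ℕ) : QPrefix :=
  (true, varsUpTo Pf i) :: Pf.drop i

/-- The complement of a literal. -/
def negLit (l : Lit) : Lit := (l.1, !l.2)

/-- `C̄`: the conjunction (CNF) of unit clauses `{¬ℓ}` for the literals `ℓ` of `C`. -/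
def negUnits (C : Clause) : CNF := C.image (fun l => ({negLit l} : Clause))

/-- The outer clause `OC(Pf, D, m)`: literals of `D` other than `m` at or to the left
of `m`. -/
noncomputable def outerClause (Pf : QPrefix) (D : Clause) (m : Lit) : Clause :=
  (D.erase m).filter (fun k => levelLE Pf k.1 m.1)

/-- The outer resolvent `OR(Pf, C, D, ℓ)`. -/
noncomputable def outerResolvent (Pf : QPrefix) (C D : Clause) (l : Lit) : Clause :=
  C.erase l ∪ outerClause Pf D (negLit l)

/-- Property QIOR⁺ of a clause `C` on literal `ℓ ∈ C` with respect to `Pf.ψ`. -/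
def QIORplus (Pf : QPrefix) (ψ : CNF) (C : Clause) (l : Lit) : Prop :=
  l ∈ C ∧ ∀ D ∈ ψ, negLit l ∈ D → LogEquiv Pf ψ (insert (outerResolvent Pf C D l) ψ)

/-- Restrict every block of a prefix to the variable set `V`. -/
def restrictPrefix (Pf : QPrefix) (V : Finset Var) : QPrefix :=
  Pf.map (fun p => (p.1, p.2 ∩ V))

/-- Normal form of a prefix: drop empty blocks and merge adjacent blocks carrying the
same quantifier. -/
def normalize : QPrefix → QPrefix
  | [] => []
  | p :: Pf =>
    let r := normalize Pf
    if p.2 = ∅ then r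
    else
      match r with
      | [] => [p]
      | q :: r' => if p.1 = q.1 then (p.1, p.2 ∪ q.2) :: r' else p :: q :: r'

/-- `Pf'` extends `Pf` by the new variables `S`, placed arbitrarily in the prefix:
the variables of `Pf'` are those of `Pf` together with `S`, and removing `S` from
`Pf'` gives back `Pf` (up to empty blocks and block splitting). -/
def PrefixExtends (Pf Pf' : QPrefix) (S : Finset Var) : Prop :=
  Disjoint (prefixVars Pf) S ∧
  prefixVars Pf' = prefixVars Pf ∪ S ∧
  normalize (restrictPrefix Pf' (prefixVars Pf)) = normalize Pf

/-- Renaming of a literal with respect to a set `S` of variables. -/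
def renameLit (S : Finset Var) (l : Lit) : Lit := if l.1 ∈ S then negLit l else l
/-- Renaming of a clause. -/
def renameClause (S : Finset Var) (C : Clause) : Clause := C.image (renameLit S)
/-- Renaming of a CNF matrix. -/
def renameCNF (S : Finset Var) (φ : CNF) : CNF := φ.image (renameClause S)


theorem mem_prefixVars {Pf : QPrefix} {v : Var} :
    v ∈ prefixVars Pf ↔ ∃ p ∈ Pf, v ∈ p.2 := by
  induction Pf with
  | nil => simp [prefixVars]
  | cons p Pf ih =>
    have h : prefixVars (p :: Pf) = p.2 ∪ prefixVars Pf := rfl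
    simp [h, ih]

theorem mem_varsUpTo {Pf : QPrefix} {v : Var} {i : ℕ} :
    v ∈ varsUpTo Pf i ↔ ∃ j < i, hasLevel Pf v j := by
  simp only [varsUpTo, mem_prefixVars, hasLevel, List.mem_take_iff_getElem, List.get_eq_getElem]
  constructor
  · rintro ⟨p, ⟨j, hj, rfl⟩, hv⟩
    exact ⟨j, by omega, by omega, hv⟩
  · rintro ⟨j, hji, hj, hv⟩
    exact ⟨_, ⟨j, by omega, rfl⟩, hv⟩

theorem varsUpTo_mono {Pf : QPrefix} {i j : ℕ} (h : i ≤ j) : varsUpTo Pf i ⊆ varsUpTo Pf j := by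
  intro v hv
  obtain ⟨k, hk, hl⟩ := mem_varsUpTo.1 hv
  exact mem_varsUpTo.2 ⟨k, by omega, hl⟩

/-- The blocks of a prefix are pairwise disjoint. -/
abbrev DisjointBlocks (Pf : QPrefix) : Prop := Pf.Pairwise (fun p q => Disjoint p.2 q.2)

theorem hasLevel_unique {Pf : QPrefix} (hd : DisjointBlocks Pf) {v : Var} {i j : ℕ}
    (hi : hasLevel Pf v i) (hj : hasLevel Pf v j) : i = j := by
  obtain ⟨hi, hvi⟩ := hi
  obtain ⟨hj, hvj⟩ := hj
  rw [DisjointBlocks, List.pairwise_iff_getElem] at hd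
  rcases lt_trichotomy i j with h | h | h
  · exact absurd hvj (Finset.disjoint_left.1 (hd i j hi hj h) hvi)
  · exact h
  · exact absurd hvi (Finset.disjoint_left.1 (hd j i hj hi h) hvj)

theorem isExistential_iff {Pf : QPrefix} {v : Var} :
    IsExistential Pf v ↔
      ∃ i, ∃ hi : i < Pf.length, (Pf.get ⟨i, hi⟩).1 = true ∧ v ∈ (Pf.get ⟨i, hi⟩).2 := by
  constructor
  · rintro ⟨p, hp, h1, h2⟩
    obtain ⟨i, hi, rfl⟩ := List.mem_iff_getElem.1 hp
    exact ⟨i, hi, h1, h2⟩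
  · rintro ⟨i, hi, h1, h2⟩
    exact ⟨_, List.get_mem _ _, h1, h2⟩

theorem clauseVars_subset {φ : CNF} {D : Clause} (hD : D ∈ φ) : clauseVars D ⊆ cnfVars φ :=
  Finset.le_sup (f := clauseVars) hD

theorem mem_cnfVars {φ : CNF} {D : Clause} {k : Lit} (hD : D ∈ φ) (hk : k ∈ D) :
    k.1 ∈ cnfVars φ :=
  clauseVars_subset hD (Finset.mem_image_of_mem _ hk)

theorem cnfSat_congr {φ : CNF} {a b : Assignment} (h : ∀ v ∈ cnfVars φ, a v = b v)
    (ha : cnfSat a φ) : cnfSat b φ := by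
  intro D hD
  obtain ⟨k, hk, hs⟩ := ha D hD
  exact ⟨k, hk, (h _ (mem_cnfVars hD hk)).symm.trans hs⟩

theorem override_of_mem {a b : Assignment} {X : Finset Var} {v : Var} (h : v ∈ X) :
    override a X b v = b v := if_pos h

theorem override_of_notMem {a b : Assignment} {X : Finset Var} {v : Var} (h : v ∉ X) :
    override a X b v = a v := if_neg h

theorem QEval_mono {φ ψ : CNF} (h : ψ ⊆ φ) {Pf : QPrefix} {a : Assignment}
    (ha : QEval Pf φ a) : QEval Pf ψ a := by
  induction Pf generalizing a with
  | nil => exact fun D hD => ha D (h hD)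
  | cons p Pf ih =>
    rcases p with ⟨_ | _, X⟩
    · exact fun b => ih (ha b)
    · obtain ⟨b, hb⟩ := ha
      exact ⟨b, ih hb⟩

theorem QEval_restrictPrefix {φ : CNF} {Pf : QPrefix} {a b : Assignment}
    (hab : ∀ v ∈ cnfVars φ, a v = b v) (ha : QEval Pf φ a) :
    QEval (restrictPrefix Pf (cnfVars φ)) φ b := by
  induction Pf generalizing a b with
  | nil => exact cnfSat_congr hab ha
  | cons p Pf ih =>
    have key : ∀ (X : Finset Var) (c : Assignment), ∀ v ∈ cnfVars φ,
        override a X c v = override b (X ∩ cnfVars φ) c v := by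
      intro X c v hv
      by_cases hX : v ∈ X
      · rw [override_of_mem hX, override_of_mem (Finset.mem_inter.2 ⟨hX, hv⟩)]
      · rw [override_of_notMem hX, override_of_notMem (fun h => hX (Finset.mem_inter.1 h).1),
          hab v hv]
    rcases p with ⟨_ | _, X⟩
    · exact fun c => ih (key X c) (ha c)
    · obtain ⟨c, hc⟩ := ha
      exact ⟨c, ih (key X c) hc⟩

theorem QEval_drop_of_isModel {Pf : QPrefix} {φ : CNF} {σ : SkolemFamily}
    (hd : DisjointBlocks Pf) (hσ : IsModel Pf φ σ) {i : ℕ} (hi : i ≤ Pf.length) (a : Assignment)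
    (ha : ∀ v, IsExistential Pf v → v ∈ varsUpTo Pf i → a v = σ v a) :
    QEval (Pf.drop i) φ a := by
  induction hi using Nat.decreasingInduction generalizing a with
  | self =>
    rw [List.drop_length]
    refine hσ.2 a fun v hv => ha v hv ?_
    rw [varsUpTo, List.take_length, mem_prefixVars]
    obtain ⟨p, hp, -, hvp⟩ := hv
    exact ⟨p, hp, hvp⟩
  | of_succ i hi ih =>
    rw [List.drop_eq_getElem_cons hi]
    have key : ∀ b : Assignment, (Pf[i].1 = true → ∀ v ∈ Pf[i].2, b v = σ v a) →
        QEval (Pf.drop (i + 1)) φ (override a Pf[i].2 b) := by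
      intro b hb
      have hagree : ∀ j ≤ i, ∀ w ∈ varsUpTo Pf j, a w = override a Pf[i].2 b w := by
        intro j hj w hw
        obtain ⟨k, hk, hwk⟩ := mem_varsUpTo.1 hw
        refine (override_of_notMem fun hwi => ?_).symm
        have := hasLevel_unique hd hwk ⟨hi, hwi⟩
        omega
      refine ih _ fun v hv hvi => ?_
      obtain ⟨j, hj, hjt, hvj⟩ := isExistential_iff.1 hv
      obtain ⟨k, hk, hvk⟩ := mem_varsUpTo.1 hvi
      obtain rfl := hasLevel_unique hd ⟨hj, hvj⟩ hvk
      rw [← hσ.1 j hj hjt v hvj _ _ (hagree j (by omega))]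
      rcases Nat.lt_or_ge j i with h | h
      · have hv' : v ∈ varsUpTo Pf i := mem_varsUpTo.2 ⟨j, h, hj, hvj⟩
        rw [← hagree i le_rfl v hv', ha v hv hv']
      · obtain rfl : j = i := by omega
        exact (override_of_mem hvj).trans (hb hjt v hvj)
    generalize Pf[i] = p at key
    rcases p with ⟨_ | _, X⟩
    · exact fun b => key b fun h => by simp at h
    · exact ⟨fun v => σ v a, key _ fun _ _ _ => rfl⟩

theorem QTrue_of_isModel {Pf : QPrefix} {φ : CNF} {σ : SkolemFamily}
    (hd : DisjointBlocks Pf) (hσ : IsModel Pf φ σ) : QTrue Pf φ := by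
  refine QEval_drop_of_isModel hd hσ (Nat.zero_le _) _ fun v _ hv => ?_
  obtain ⟨j, hj, -⟩ := mem_varsUpTo.1 hv
  omega

/-- The assignment `a` cut down to the variables of the first `i` blocks. -/
noncomputable def outerPart (Pf : QPrefix) (i : ℕ) (a : Assignment) : Assignment :=
  override (fun _ => false) (varsUpTo Pf i) a

theorem outerPart_congr {Pf : QPrefix} {i : ℕ} {a b : Assignment}
    (h : ∀ w ∈ varsUpTo Pf i, a w = b w) : outerPart Pf i a = outerPart Pf i b := by
  funext v
  by_cases hv : v ∈ varsUpTo Pf i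
  · simp only [outerPart, override_of_mem hv, h v hv]
  · simp only [outerPart, override_of_notMem hv]

theorem override_outerPart {Pf : QPrefix} {i : ℕ} (hi : i < Pf.length) {a b : Assignment}
    (h : ∀ v ∈ Pf[i].2, a v = b v) :
    override (outerPart Pf i a) Pf[i].2 b = outerPart Pf (i + 1) a := by
  funext v
  by_cases hv : v ∈ Pf[i].2
  · have hv' : v ∈ varsUpTo Pf (i + 1) := mem_varsUpTo.2 ⟨i, by omega, hi, hv⟩
    rw [override_of_mem hv, outerPart, override_of_mem hv', h v hv]
  · rw [override_of_notMem hv]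
    by_cases hvi : v ∈ varsUpTo Pf i
    · simp only [outerPart, override_of_mem hvi,
        override_of_mem (varsUpTo_mono (Nat.le_succ i) hvi)]
    · have hv' : v ∉ varsUpTo Pf (i + 1) := by
        intro hc
        obtain ⟨j, hj, hvj⟩ := mem_varsUpTo.1 hc
        rcases Nat.lt_or_ge j i with hji | hji
        · exact hvi (mem_varsUpTo.2 ⟨j, hji, hvj⟩)
        · obtain rfl : j = i := by omega
          exact hv hvj.2
      simp only [outerPart, override_of_notMem hvi, override_of_notMem hv']

theorem exists_isModel_of_QTrue {Pf : QPrefix} {φ : CNF} (hclosed : ClosedQBF Pf φ)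
    (ht : QTrue Pf φ) : ∃ σ, IsModel Pf φ σ := by
  obtain ⟨hd, hvars⟩ := hclosed
  let lev : Var → ℕ := fun v => Classical.epsilon (hasLevel Pf v)
  have hlev : ∀ {v i}, hasLevel Pf v i → lev v = i := fun {v i} h =>
    hasLevel_unique hd (Classical.epsilon_spec (p := hasLevel Pf v) ⟨i, h⟩) h
  let F : ℕ → Assignment → Assignment := fun i c =>
    Classical.epsilon fun b => QEval (Pf.drop (i + 1)) φ (override c (Pf[i]?.getD default).2 b)
  refine ⟨fun v a => F (lev v) (outerPart Pf (lev v) a) v, ?_, ?_⟩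
  · intro i hi _ v hv a b hab
    obtain rfl := hlev ⟨hi, hv⟩
    simp only [outerPart_congr hab]
  · intro a ha
    have key : ∀ i ≤ Pf.length, QEval (Pf.drop i) φ (outerPart Pf i a) := by
      intro i
      induction i with
      | zero =>
        intro _
        have : outerPart Pf 0 a = fun _ => false := by
          funext v
          exact override_of_notMem fun h => by
            obtain ⟨j, hj, -⟩ := mem_varsUpTo.1 h
            omega
        rw [this]
        exact ht
      | succ i ih =>
        intro hi
        have hi : i < Pf.length := hi
        have h := ih hi.le
        rw [List.drop_eq_getElem_cons hi] at h
        have hall : Pf[i].1 = false →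
            ∀ b, QEval (Pf.drop (i + 1)) φ (override (outerPart Pf i a) Pf[i].2 b) := by
          intro hq
          generalize Pf[i] = p at h hq
          rcases p with ⟨_, X⟩
          subst hq
          exact h
        have hex : Pf[i].1 = true →
            ∃ b, QEval (Pf.drop (i + 1)) φ (override (outerPart Pf i a) Pf[i].2 b) := by
          intro hq
          generalize Pf[i] = p at h hq
          rcases p with ⟨_, X⟩
          subst hq
          exact h
        cases hq : Pf[i].1 with
        | false =>
          rw [← override_outerPart hi fun _ _ => rfl]
          exact hall hq a
        | true =>
          have hget : Pf[i]?.getD default = Pf[i] := by simp [hi]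
          have hF : QEval (Pf.drop (i + 1)) φ
              (override (outerPart Pf i a) Pf[i].2 (F i (outerPart Pf i a))) := by
            have := Classical.epsilon_spec (hex hq)
            simpa only [F, hget] using this
          rwa [override_outerPart hi] at hF
          intro v hv
          have := ha v (isExistential_iff.2 ⟨i, hi, hq, hv⟩)
          simpa only [hlev ⟨hi, hv⟩] using this
    have h := key _ le_rfl
    rw [List.drop_length] at h
    refine cnfSat_congr (fun v hv => ?_) h
    refine override_of_mem ?_
    rw [varsUpTo, List.take_length]
    exact hvars hv

theorem hasLevel_restrictPrefix {Pf : QPrefix} {V : Finset Var} {v : Var} {i : ℕ} :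
    hasLevel (restrictPrefix Pf V) v i ↔ hasLevel Pf v i ∧ v ∈ V := by
  simp [hasLevel, restrictPrefix]

theorem isExistential_restrictPrefix {Pf : QPrefix} {V : Finset Var} {v : Var} :
    IsExistential (restrictPrefix Pf V) v ↔ IsExistential Pf v ∧ v ∈ V := by
  simp only [IsExistential, restrictPrefix, List.mem_map]
  constructor
  · rintro ⟨_, ⟨p, hp, rfl⟩, h, hv⟩
    exact ⟨⟨p, hp, h, (Finset.mem_inter.1 hv).1⟩, (Finset.mem_inter.1 hv).2⟩
  · rintro ⟨⟨p, hp, h, hv⟩, hV⟩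
    exact ⟨_, ⟨p, hp, rfl⟩, h, Finset.mem_inter.2 ⟨hv, hV⟩⟩

theorem ClosedQBF.restrictPrefix {Pf : QPrefix} {φ : CNF} (h : ClosedQBF Pf φ) :
    ClosedQBF (restrictPrefix Pf (cnfVars φ)) φ := by
  refine ⟨?_, fun v hv => ?_⟩
  · rw [QHornProlog.restrictPrefix, List.pairwise_map]
    exact h.1.imp fun hpq => hpq.mono Finset.inter_subset_left Finset.inter_subset_left
  · obtain ⟨p, hp, hvp⟩ := mem_prefixVars.1 (h.2 hv)
    exact mem_prefixVars.2 ⟨_, List.mem_map_of_mem hp, Finset.mem_inter.2 ⟨hvp, hv⟩⟩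

theorem levelLE_of_restrictPrefix {Pf : QPrefix} {V : Finset Var} {v w : Var}
    (h : levelLE (restrictPrefix Pf V) v w) : levelLE Pf v w := by
  obtain ⟨i, j, hij, hi, hj⟩ := h
  exact ⟨i, j, hij, (hasLevel_restrictPrefix.1 hi).1, (hasLevel_restrictPrefix.1 hj).1⟩

/-- Skolem functions for a restricted prefix extend to the whole prefix. -/
theorem exists_dependsOnlyOuter_of_restrictPrefix {Pf : QPrefix} {V : Finset Var}
    {σ : SkolemFamily} (hσ : DependsOnlyOuter (restrictPrefix Pf V) σ) :
    ∃ τ, DependsOnlyOuter Pf τ ∧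
      ∀ a, ConsistentWith Pf τ a → ConsistentWith (restrictPrefix Pf V) σ a := by
  refine ⟨fun v a => if v ∈ V then σ v a else false, ?_, ?_⟩
  · intro i hi hq v hv a b hab
    by_cases hV : v ∈ V
    · simp only [if_pos hV]
      refine hσ i (by simpa [restrictPrefix] using hi) (by simpa [restrictPrefix] using hq) v
        (by simpa [restrictPrefix] using ⟨hv, hV⟩) a b fun w hw => hab w ?_
      obtain ⟨j, hj, hwj⟩ := mem_varsUpTo.1 hw
      exact mem_varsUpTo.2 ⟨j, hj, (hasLevel_restrictPrefix.1 hwj).1⟩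
    · simp only [if_neg hV]
  · intro a ha v hv
    obtain ⟨he, hV⟩ := isExistential_restrictPrefix.1 hv
    simpa only [if_pos hV] using ha v he

theorem eq_of_ne_negLit {k l : Lit} (hv : k.1 = l.1) (hne : k ≠ negLit l) : k = l := by
  rcases k with ⟨x, p⟩
  rcases l with ⟨y, q⟩
  cases p <;> cases q <;> simp_all [negLit]

/-- If the outer resolvents of `C` on the existential literal `l` hold under all assignments
consistent with Skolem functions for `ψ`, these functions can be modified to satisfy `C` too. -/
theorem exists_isModel_insert {Pf : QPrefix} {ψ : CNF} {C : Clause} {l : Lit} {σ : SkolemFamily}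
    (hd : DisjointBlocks Pf) (hexist : IsExistential Pf l.1) (hl : l ∈ C) (hσ : IsModel Pf ψ σ)
    (hOR : ∀ D ∈ ψ, negLit l ∈ D → ∀ a, ConsistentWith Pf σ a →
      clauseSat a (outerResolvent Pf C D l)) :
    ∃ τ, IsModel Pf (insert C ψ) τ := by
  obtain ⟨i, hi, hq, hx⟩ := isExistential_iff.1 hexist
  obtain ⟨hdep, hsat⟩ := hσ
  have hxlev : hasLevel Pf l.1 i := ⟨hi, hx⟩
  have hxi : l.1 ∉ varsUpTo Pf i := fun h => by
    obtain ⟨j, hj, hlj⟩ := mem_varsUpTo.1 h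
    have := hasLevel_unique hd hlj hxlev
    omega
  let P : Assignment → Prop := fun a => ∃ b, ConsistentWith Pf σ b ∧
    (∀ w ∈ varsUpTo Pf i, b w = a w) ∧ ¬ clauseSat b (C.erase l)
  let up : Assignment → Assignment := fun a => Function.update a l.1 (σ l.1 a)
  have up_self : ∀ a, up a l.1 = σ l.1 a := fun a => Function.update_self ..
  have up_ne : ∀ a {v}, v ≠ l.1 → up a v = a v := fun a v h => Function.update_of_ne h ..
  refine ⟨fun v a => if v = l.1 then (if P a then l.2 else σ l.1 a) else σ v (up a), ?_, ?_⟩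
  · intro j hj hjq v hv a b hab
    by_cases hvx : v = l.1
    · subst hvx
      obtain rfl := hasLevel_unique hd ⟨hj, hv⟩ hxlev
      have hP : P a ↔ P b := by
        constructor
        · rintro ⟨c, h1, h2, h3⟩
          exact ⟨c, h1, fun w hw => (h2 w hw).trans (hab w hw), h3⟩
        · rintro ⟨c, h1, h2, h3⟩
          exact ⟨c, h1, fun w hw => (h2 w hw).trans (hab w hw).symm, h3⟩
      simp only [if_true, hP, hdep j hj hjq _ hv a b hab]
    · simp only [if_neg hvx]
      refine hdep j hj hjq v hv _ _ fun w hw => ?_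
      by_cases hwx : w = l.1
      · subst hwx
        obtain ⟨k, hk, hlk⟩ := mem_varsUpTo.1 hw
        obtain rfl := hasLevel_unique hd hlk hxlev
        rw [up_self, up_self]
        exact hdep k hi hq _ hx a b fun w hw => hab w (varsUpTo_mono hk.le hw)
      · rw [up_ne a hwx, up_ne b hwx, hab w hw]
  · intro a ha
    have hup : ConsistentWith Pf σ (up a) := by
      intro v hv
      by_cases hvx : v = l.1
      · subst hvx
        rw [up_self]
        refine hdep i hi hq _ hx _ _ fun w hw => (up_ne a ?_).symm
        rintro rfl
        exact hxi hw
      · rw [up_ne a hvx]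
        simpa only [if_neg hvx] using ha v hv
    have hax : a l.1 = if P a then l.2 else σ l.1 a := by
      simpa only [if_true] using ha l.1 hexist
    have hup_i : ∀ w ∈ varsUpTo Pf i, up a w = a w := fun w hw =>
      up_ne a (by rintro rfl; exact hxi hw)
    by_cases hP : P a
    · rw [if_pos hP] at hax
      intro D hD
      rcases Finset.mem_insert.1 hD with rfl | hD
      · exact ⟨l, hl, hax⟩
      by_cases hneg : negLit l ∈ D
      · obtain ⟨b, hb, hba, hbC⟩ := hP
        obtain ⟨k, hk, hks⟩ := hOR D hD hneg b hb
        rcases Finset.mem_union.1 hk with hk | hk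
        · exact absurd ⟨k, hk, hks⟩ hbC
        obtain ⟨hkD, hlev⟩ := Finset.mem_filter.1 hk
        obtain ⟨hkne, hkD⟩ := Finset.mem_erase.1 hkD
        refine ⟨k, hkD, ?_⟩
        by_cases hkx : k.1 = l.1
        · rw [eq_of_ne_negLit hkx hkne]
          exact hax
        obtain ⟨j, j', hjj, hkj, hj'⟩ := hlev
        obtain rfl := hasLevel_unique hd hj' hxlev
        suffices h : b k.1 = a k.1 from h.symm.trans hks
        rcases hjj.lt_or_eq with hlt | rfl
        · exact hba _ (mem_varsUpTo.2 ⟨j, hlt, hkj⟩)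
        · have hke := isExistential_iff.2 ⟨j, hi, hq, hkj.2⟩
          rw [← up_ne a hkx, hb _ hke, hup _ hke]
          exact hdep j hi hq _ hkj.2 _ _ fun w hw => (hba w hw).trans (hup_i w hw).symm
      · obtain ⟨k, hk, hks⟩ := hsat _ hup D hD
        refine ⟨k, hk, ?_⟩
        by_cases hkx : k.1 = l.1
        · rw [eq_of_ne_negLit hkx fun h => hneg (h ▸ hk)]
          exact hax
        · exact (up_ne a hkx).symm.trans hks
    · rw [if_neg hP] at hax
      have hupa : up a = a := by
        funext v
        by_cases hvx : v = l.1
        · rw [hvx, up_self, hax]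
        · exact up_ne a hvx
      rw [hupa] at hup
      intro D hD
      rcases Finset.mem_insert.1 hD with rfl | hD
      · by_contra hc
        refine hP ⟨a, hup, fun _ _ => rfl, ?_⟩
        rintro ⟨k, hk, hks⟩
        exact hc ⟨k, Finset.mem_of_mem_erase hk, hks⟩
      · exact hsat a hup D hD

/-- If `C ∈ φ` has property QIOR⁺ on an existential literal `ℓ ∈ C`
with respect to `Pf'.φ'` where `φ' = φ \ {C}` and `Pf'` is `Pf` with the variables
no longer occurring in `φ'` removed, then `Pf.φ` and `Pf'.φ'` are
satisfiability-equivalent. -/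
theorem statement_13 (Pf : QPrefix) (φ : CNF) (hclosed : ClosedQBF Pf φ)
    (C : Clause) (hC : C ∈ φ) (l : Lit) (hexist : IsExistential Pf l.1)
    (hqior : QIORplus (restrictPrefix Pf (cnfVars (φ.erase C))) (φ.erase C) C l) :
    (QTrue Pf φ ↔ QTrue (restrictPrefix Pf (cnfVars (φ.erase C))) (φ.erase C)) := by
  have hsub : φ.erase C ⊆ φ := Finset.erase_subset C φ
  constructor
  · exact fun h => QEval_restrictPrefix (fun _ _ => rfl) (QEval_mono hsub h)
  · intro h
    have hclosed' : ClosedQBF Pf (φ.erase C) :=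
      ⟨hclosed.1, (Finset.sup_mono hsub).trans hclosed.2⟩
    obtain ⟨σ, hσ⟩ := exists_isModel_of_QTrue hclosed'.restrictPrefix h
    obtain ⟨τ, hτ, hτσ⟩ := exists_dependsOnlyOuter_of_restrictPrefix hσ.1
    obtain ⟨ρ, hρ⟩ := exists_isModel_insert hclosed.1 hexist hqior.1
      (⟨hτ, fun a ha => hσ.2 a (hτσ a ha)⟩ : IsModel Pf (φ.erase C) τ) (by
        intro D hD hneg a ha
        obtain ⟨k, hk, hks⟩ := ((hqior.2 D hD hneg σ).1 hσ).2 a (hτσ a ha) _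
          (Finset.mem_insert_self _ _)
        refine ⟨k, ?_, hks⟩
        rcases Finset.mem_union.1 hk with hk | hk
        · exact Finset.mem_union_left _ hk
        · obtain ⟨hkD, hle⟩ := Finset.mem_filter.1 hk
          exact Finset.mem_union_right _
            (Finset.mem_filter.2 ⟨hkD, levelLE_of_restrictPrefix hle⟩))
    rw [Finset.insert_erase hC] at hρ
    exact QTrue_of_isModel hclosed.1 hρ

end QHornProlog
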